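/- Let 0 ≤ μ < ν ≤ 1 and T > 0. If φ : [0,T] → L²(Ω) is continuous with φ(0) = 0, its restriction to (0,T] is differentiable, and there is a constant C₀ such that ‖φ′(t)‖ ≤ C₀ t^{−μ} for 0 < t ≤ T, then for every t ∈ (0,T], ‖φ(t)‖² ≤ 2 ω_{2−ν}(t) ∫_0^t ⟨φ′(s), (I^ν φ′)(s)⟩ ds. -/

import Mathlib

open MeasureTheory Real Set
open scoped RealInnerProductSpace

/-- `ω_μ(t) = t^{μ-1}/Γ(μ)`. -/
noncomputable def omegaK (μ t : ℝ) : ℝ := t ^ (μ - 1) / Real.Gamma μ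

/-- Riemann–Liouville fractional integral of order `μ` of an `H`-valued function,
with `I^0 φ = φ`. -/
noncomputable def fracInt {H : Type*} [NormedAddCommGroup H] [NormedSpace ℝ H]
    (μ : ℝ) (φ : ℝ → H) (t : ℝ) : H :=
  if μ = 0 then φ t else ∫ s in (0:ℝ)..t, omegaK μ (t - s) • φ s

lemma exp_energy {H : Type*} [NormedAddCommGroup H] [InnerProductSpace ℝ H] [CompleteSpace H]
    (l t : ℝ) (hl : 0 ≤ l) (ht : 0 < t) (φ f : ℝ → H) (hφ : Continuous φ) (h0 : φ 0 = 0)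
    (hd : ∀ s ∈ Ioo 0 t, HasDerivAt φ (f s) s) (hf : IntervalIntegrable f volume 0 t) :
    ‖φ t‖ ^ 2 ≤ (2 + l * t) *
      ∫ s in Ioc 0 t, ⟪f s, ∫ r in Ioc 0 s, exp (-(l * (s - r))) • f r⟫ := by
  have hc1 : Continuous fun r => (l * exp (l * r)) • φ r := by fun_prop
  obtain ⟨v, hv⟩ : ∃ v : ℝ → H, v = fun s => φ s - exp (-(l * s)) • ∫ r in (0:ℝ)..s, (l * exp (l * r)) • φ r :=
    ⟨_, rfl⟩
  have hP : ∀ s, HasDerivAt (fun s => ∫ r in (0:ℝ)..s, (l * exp (l * r)) • φ r)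
      ((l * exp (l * s)) • φ s) s := fun s => (hc1.integral_hasStrictDerivAt 0 s).hasDerivAt
  have hPc : Continuous (fun s => ∫ r in (0:ℝ)..s, (l * exp (l * r)) • φ r) :=
    continuous_iff_continuousAt.2 fun s => (hP s).continuousAt
  have hvc : Continuous v := by rw [hv]; fun_prop
  have hv0 : v 0 = 0 := by simp [hv, h0]
  have hE : ∀ c s : ℝ, HasDerivAt (fun s => exp (c * s)) (c * exp (c * s)) s := by
    intro c s
    have := ((hasDerivAt_id s).const_mul c).exp
    simpa [mul_comm] using this
  have hvd : ∀ s ∈ Ioo 0 t, HasDerivAt v (f s - l • v s) s := by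
    intro s hs
    have h1 := (hd s hs).sub ((hE (-l) s).smul (hP s))
    have h2 : v = φ - fun s => exp (-l * s) • ∫ r in (0:ℝ)..s, (l * exp (l * r)) • φ r := by
      rw [hv]; ext1 s; simp
    rw [h2]
    refine h1.congr_deriv ?_
    have h3 : exp (-l * s) * exp (l * s) = 1 := by rw [← exp_add]; simp
    simp only [Pi.sub_apply, smul_sub, smul_smul]
    rw [show exp (-l * s) * (l * exp (l * s)) = l by linear_combination l * h3]
    module
  have hu : ∀ s ∈ Icc 0 t, ∫ r in Ioc 0 s, exp (-(l * (s - r))) • f r = v s := by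
    intro s hs
    have hfs : IntervalIntegrable f volume 0 s := by
      apply hf.mono_set
      rw [uIcc_of_le hs.1, uIcc_of_le ht.le]
      exact Icc_subset_Icc_right hs.2
    have key : ∫ r in (0:ℝ)..s, exp (l * r) • f r = exp (l * s) • v s - exp (l * 0) • v 0 := by
      apply intervalIntegral.integral_eq_sub_of_hasDerivAt_of_le hs.1 (f := fun s => exp (l * s) • v s)
      · fun_prop
      · intro x hx
        refine ((hE l x).smul (hvd x ⟨hx.1, hx.2.trans_le hs.2⟩)).congr_deriv ?_
        module
      · exact hfs.continuousOn_smul (by fun_prop)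
    rw [← intervalIntegral.integral_of_le hs.1]
    have : ∀ r, exp (-(l * (s - r))) • f r = exp (-(l * s)) • (exp (l * r) • f r) := by
      intro r; rw [smul_smul, ← exp_add]; ring_nf
    simp_rw [this]
    rw [intervalIntegral.integral_smul, key, hv0, smul_zero, sub_zero, smul_smul, ← exp_add]
    simp
  have hQ : ∫ s in Ioc 0 t, ⟪f s, ∫ r in Ioc 0 s, exp (-(l * (s - r))) • f r⟫
      = ∫ s in (0:ℝ)..t, ⟪f s, v s⟫ := by
    rw [intervalIntegral.integral_of_le ht.le]
    exact setIntegral_congr_fun measurableSet_Ioc fun s hs => by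
      simp only [hu s (Ioc_subset_Icc_self hs)]
  have hvi : IntervalIntegrable v volume 0 t := hvc.intervalIntegrable _ _
  have hni : IntervalIntegrable (fun s => ‖v s‖) volume 0 t := hvc.norm.intervalIntegrable _ _
  have hn2i : IntervalIntegrable (fun s => ‖v s‖^2) volume 0 t :=
    (hvc.norm.pow 2).intervalIntegrable _ _
  have hfv : IntervalIntegrable (fun s => ⟪f s, v s⟫) volume 0 t := by
    obtain ⟨C, hC⟩ := (isCompact_Icc (a := (0:ℝ)) (b := t)).exists_bound_of_continuousOn hvc.continuousOn
    rw [intervalIntegrable_iff_integrableOn_Ioc_of_le ht.le] at hf ⊢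
    refine Integrable.mono' (hf.norm.mul_const C) (hf.aestronglyMeasurable.inner hvc.aestronglyMeasurable) ?_
    refine (ae_restrict_iff' measurableSet_Ioc).2 (Filter.Eventually.of_forall fun s hs => ?_)
    refine (norm_inner_le_norm _ _).trans ?_
    exact mul_le_mul_of_nonneg_left (hC s (Ioc_subset_Icc_self hs)) (norm_nonneg _)
  have hlvi : IntervalIntegrable (fun s => l • v s) volume 0 t := hvi.smul l
  have e1 : (∫ s in (0:ℝ)..t, (f s - l • v s)) = v t - v 0 :=
    intervalIntegral.integral_eq_sub_of_hasDerivAt_of_le ht.le hvc.continuousOn hvd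
      (hf.sub hlvi)
  have e2 : (∫ s in (0:ℝ)..t, f s) = φ t - φ 0 :=
    intervalIntegral.integral_eq_sub_of_hasDerivAt_of_le ht.le hφ.continuousOn hd hf
  have e3 : (∫ s in (0:ℝ)..t, (2 * ⟪f s, v s⟫ - 2 * l * ‖v s‖^2)) = ‖v t‖^2 - ‖v 0‖^2 := by
    apply intervalIntegral.integral_eq_sub_of_hasDerivAt_of_le ht.le (f := fun s => ‖v s‖^2)
    · fun_prop
    · intro s hs
      refine (hvd s hs).norm_sq.congr_deriv ?_
      rw [inner_sub_right, inner_smul_right, real_inner_self_eq_norm_sq, real_inner_comm]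
      ring
    · exact (hfv.const_mul 2).sub (hn2i.const_mul _)
  rw [intervalIntegral.integral_sub hf hlvi, intervalIntegral.integral_smul, e2, h0, hv0] at e1
  rw [intervalIntegral.integral_sub (hfv.const_mul 2) (hn2i.const_mul _),
    intervalIntegral.integral_const_mul, intervalIntegral.integral_const_mul, hv0] at e3
  rw [hQ]
  have hb : ‖φ t‖ ≤ ‖v t‖ + l * ∫ s in (0:ℝ)..t, ‖v s‖ := by
    have : φ t = v t + l • ∫ s in (0:ℝ)..t, v s := by
      simp only [sub_zero] at e1; rw [← e1]; abel
    rw [this]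
    refine (norm_add_le _ _).trans ?_
    rw [norm_smul, Real.norm_of_nonneg hl]
    gcongr
    exact intervalIntegral.norm_integral_le_integral_norm ht.le
  have hb0 : 0 ≤ ∫ s in (0:ℝ)..t, ‖v s‖ :=
    intervalIntegral.integral_nonneg ht.le fun _ _ => norm_nonneg _
  set b := ∫ s in (0:ℝ)..t, ‖v s‖ with hbdef
  set c := ∫ s in (0:ℝ)..t, ‖v s‖^2 with hcdef
  set a := ‖v t‖ with hadef
  set E := ∫ s in (0:ℝ)..t, ⟪f s, v s⟫
  have hbc : b ^ 2 / t ≤ c := by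
    have : 0 ≤ ∫ s in (0:ℝ)..t, (‖v s‖ - b / t)^2 :=
      intervalIntegral.integral_nonneg ht.le fun _ _ => sq_nonneg _
    have h4 : ∀ s, (‖v s‖ - b / t)^2 = ‖v s‖^2 - (2 * (b / t)) * ‖v s‖ + (b/t)^2 := by intro s; ring
    simp_rw [h4] at this
    rw [intervalIntegral.integral_add (hn2i.sub (hni.const_mul _)) (by simp),
      intervalIntegral.integral_sub hn2i (hni.const_mul _), intervalIntegral.integral_const_mul,
      intervalIntegral.integral_const, ← hbdef, ← hcdef, sub_zero, smul_eq_mul] at this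
    have h5 : c - 2 * (b / t) * b + t * (b / t)^2 = c - b^2/t := by field_simp; ring
    linarith
  have hE' : E = a^2/2 + l * c := by simp at e3; linarith
  have ha0 : 0 ≤ a := norm_nonneg _
  have h6 : 2 * a * b ≤ 2 * (b^2/t) + t * a^2/2 := by
    have : 2 * (b^2/t) + t * a^2/2 - 2 * a * b = (t * a - 2 * b)^2 / (2*t) := by field_simp; ring
    have : 0 ≤ (t * a - 2 * b)^2 / (2*t) := by positivity
    linarith
  have h7 : b^2 ≤ t * c := by rwa [div_le_iff₀ ht, mul_comm] at hbc
  calc ‖φ t‖^2 ≤ (a + l * b)^2 := by gcongr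
    _ = a^2 + l * (2 * a * b) + l^2 * b^2 := by ring
    _ ≤ a^2 + l * (2 * c + t * a^2/2) + l^2 * (t * c) := by
        gcongr; linarith
    _ = (2 + l * t) * E := by rw [hE']; ring

lemma exp_bound (l s m : ℝ) (hl : 0 < l) (hs : 0 < s) (hm0 : 0 ≤ m) (hm : m < 1) :
    ∫ r in Ioc 0 s, exp (-(l * (s - r))) * r ^ (-m) ≤
      min (s ^ (1 - m) / (1 - m)) ((1 / (1 - m) + 1) * l ^ (m - 1)) := by
  have hIntg : ∀ a : ℝ, 0 ≤ a → IntegrableOn (fun r : ℝ => r ^ (-m)) (Ioc 0 a) := by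
    intro a ha
    have := intervalIntegral.intervalIntegrable_rpow' (a := 0) (b := a) (r := -m) (by linarith)
    rwa [intervalIntegrable_iff_integrableOn_Ioc_of_le ha] at this
  have hval : ∀ a : ℝ, 0 ≤ a → ∫ r in Ioc 0 a, r ^ (-m) = a ^ (1 - m) / (1 - m) := by
    intro a ha
    rw [← intervalIntegral.integral_of_le ha, integral_rpow (Or.inl (by linarith)),
      zero_rpow (by linarith), sub_zero]
    ring_nf
  have hle : ∀ r ∈ Ioc 0 s, exp (-(l * (s - r))) ≤ 1 := by
    intro r hr
    rw [exp_le_one_iff]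
    have := mul_nonneg hl.le (sub_nonneg.2 hr.2)
    linarith
  have hmeas : ∀ S : Set ℝ, AEStronglyMeasurable (fun r : ℝ => exp (-(l * (s - r))) * r ^ (-m)) (volume.restrict S) := by
    intro S
    apply Measurable.aestronglyMeasurable
    fun_prop
  have hmain : IntegrableOn (fun r : ℝ => exp (-(l * (s - r))) * r ^ (-m)) (Ioc 0 s) := by
    refine Integrable.mono' (hIntg s hs.le) (hmeas _) ?_
    refine (ae_restrict_iff' measurableSet_Ioc).2 (Filter.Eventually.of_forall fun r hr => ?_)
    have h1 : 0 ≤ r ^ (-m) := rpow_nonneg hr.1.le _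
    rw [Real.norm_of_nonneg (by positivity)]
    nlinarith [hle r hr]
  refine le_min ?_ ?_
  · rw [← hval s hs.le]
    refine setIntegral_mono_on hmain (hIntg s hs.le) measurableSet_Ioc fun r hr => ?_
    have h1 : 0 ≤ r ^ (-m) := rpow_nonneg hr.1.le _
    nlinarith [hle r hr]
  · have hl' : 0 < 1 / l := by positivity
    have hexp : IntegrableOn (fun r => l ^ m * exp (-(l * (s - r)))) (Ioc 0 s) :=
      (Continuous.integrableOn_Ioc (by fun_prop))
    have hi1 : IntegrableOn (fun r : ℝ => (Ioc 0 (1/l)).indicator (fun r => r ^ (-m)) r) (Ioc 0 s) :=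
      ((integrable_indicator_iff measurableSet_Ioc).2 (hIntg _ hl'.le)).integrableOn
    calc ∫ r in Ioc 0 s, exp (-(l * (s - r))) * r ^ (-m)
        ≤ ∫ r in Ioc 0 s, ((Ioc 0 (1/l)).indicator (fun r => r ^ (-m)) r + l ^ m * exp (-(l * (s - r)))) := by
          refine setIntegral_mono_on hmain (hi1.add hexp) measurableSet_Ioc fun r hr => ?_
          have h1 : 0 ≤ r ^ (-m) := rpow_nonneg hr.1.le _
          by_cases h : r ≤ 1 / l
          · rw [indicator_of_mem (show r ∈ Ioc 0 (1/l) from ⟨hr.1, h⟩)]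
            have : 0 ≤ l ^ m * exp (-(l * (s - r))) := by positivity
            nlinarith [hle r hr]
          · rw [indicator_of_notMem (fun h' => h h'.2), zero_add, mul_comm]
            gcongr
            have h2 := rpow_le_rpow_of_nonpos hl' (not_le.1 h).le (neg_nonpos.2 hm0)
            refine h2.trans_eq ?_
            rw [one_div, inv_rpow hl.le, rpow_neg hl.le, inv_inv]
      _ = (∫ r in Ioc 0 s, (Ioc 0 (1/l)).indicator (fun r => r ^ (-m)) r) +
            ∫ r in Ioc 0 s, l ^ m * exp (-(l * (s - r))) := integral_add hi1 hexp
      _ ≤ (1 / l) ^ (1 - m) / (1 - m) + l ^ m * (1 / l) := by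
          gcongr
          · rw [← hval _ hl'.le, ← integral_indicator measurableSet_Ioc (s := Ioc 0 (1/l))]
            refine setIntegral_le_integral ((integrable_indicator_iff measurableSet_Ioc).2 (hIntg _ hl'.le)) ?_
            refine Filter.Eventually.of_forall fun r => ?_
            exact indicator_nonneg (fun r hr => rpow_nonneg hr.1.le _) r
          · rw [integral_const_mul]
            gcongr
            rw [← intervalIntegral.integral_of_le hs.le]
            have : ∫ r in (0:ℝ)..s, exp (-(l * (s - r))) =
                (1/l) * exp (-(l * (s - s))) - (1/l) * exp (-(l * (s - 0))) := by
              apply intervalIntegral.integral_eq_sub_of_hasDerivAt (f := fun r => (1/l) * exp (-(l * (s - r))))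
              · intro x _
                have h := ((((hasDerivAt_id x).const_sub s).const_mul l).neg.exp).const_mul (1/l)
                refine h.congr_deriv ?_
                simp
                field_simp
              · exact Continuous.intervalIntegrable (by fun_prop) _ _
            rw [this]
            have : 0 < (1/l) * exp (-(l * (s - 0))) := by positivity
            simp at this ⊢
            linarith
      _ = (1 / (1 - m) + 1) * l ^ (m - 1) := by
          rw [one_div, inv_rpow hl.le, ← rpow_neg hl.le, rpow_sub hl, rpow_one,
            show -(1 - m) = m - 1 by ring, rpow_sub hl, rpow_one]
          ring

lemma dom_integrable (m ν A B : ℝ) (hmν : m < ν) (hν : ν < 1) (hA : 0 ≤ A) (hB : 0 ≤ B) :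
    IntegrableOn (fun l : ℝ => l ^ (-ν) * min A (B * l ^ (m - 1))) (Ioi 0) := by
  have hmeas : ∀ S : Set ℝ, AEStronglyMeasurable (fun l : ℝ => l ^ (-ν) * min A (B * l ^ (m - 1))) (volume.restrict S) := by
    intro S
    apply Measurable.aestronglyMeasurable
    fun_prop
  rw [← Ioc_union_Ioi_eq_Ioi (zero_le_one (α := ℝ))]
  refine IntegrableOn.union ?_ ?_
  · have h1 : IntegrableOn (fun l : ℝ => l ^ (-ν) * A) (Ioc 0 1) := by
      have := intervalIntegral.intervalIntegrable_rpow' (a := 0) (b := 1) (r := -ν) (by linarith)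
      rw [intervalIntegrable_iff_integrableOn_Ioc_of_le zero_le_one] at this
      exact Integrable.mul_const this _
    refine Integrable.mono' h1 (hmeas _) ?_
    refine (ae_restrict_iff' measurableSet_Ioc).2 (Filter.Eventually.of_forall fun r hr => ?_)
    have := hr.1
    rw [Real.norm_of_nonneg (mul_nonneg (by positivity) (le_min hA (by positivity)))]
    gcongr
    exact min_le_left _ _
  · have h1 : IntegrableOn (fun l : ℝ => l ^ (m - 1 - ν) * B) (Ioi 1) :=
      Integrable.mul_const (integrableOn_Ioi_rpow_of_lt (by linarith) one_pos) _
    refine Integrable.mono' h1 (hmeas _) ?_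
    refine (ae_restrict_iff' measurableSet_Ioi).2 (Filter.Eventually.of_forall fun r hr => ?_)
    have hr0 : 0 < r := one_pos.trans hr
    rw [Real.norm_of_nonneg (mul_nonneg (by positivity) (le_min hA (by positivity)))]
    calc r ^ (-ν) * min A (B * r ^ (m - 1)) ≤ r ^ (-ν) * (B * r ^ (m-1)) := by
          gcongr; exact min_le_right _ _
      _ = _ := by
          rw [show m - 1 - ν = -ν + (m - 1) by ring, rpow_add hr0]; ring

lemma laplace_rpow (ν x : ℝ) (hν : ν < 1) (hx : 0 < x) :
    ∫ l in Ioi (0:ℝ), l ^ (-ν) * exp (-(x * l)) = x ^ (ν - 1) * Gamma (1 - ν) := by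
  have := Real.integral_rpow_mul_exp_neg_mul_Ioi (a := 1 - ν) (r := x) (by linarith) hx
  rw [show (1 - ν - 1) = -ν by ring] at this
  rw [this, one_div, inv_rpow hx.le, ← rpow_neg hx.le]; ring_nf

lemma laplace_integrable (ν x : ℝ) (hν : ν < 1) (hx : 0 < x) :
    IntegrableOn (fun l : ℝ => l ^ (-ν) * exp (-(x * l))) (Ioi 0) := by
  apply Integrable.of_integral_ne_zero
  rw [laplace_rpow ν x hν hx]
  have := Gamma_pos_of_pos (show 0 < 1 - ν by linarith)
  positivity

lemma stieltjes (ν t : ℝ) (hν0 : 0 < ν) (hν : ν < 1) (ht : 0 < t) :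
    IntegrableOn (fun l : ℝ => l ^ (-ν) * (1 / (2 + l * t))) (Ioi 0) ∧
    ∫ l in Ioi (0:ℝ), l ^ (-ν) * (1 / (2 + l * t)) =
      Gamma ν * Gamma (1 - ν) * (2 ^ (-ν) * t ^ (ν - 1)) := by
  have h1 : ∀ l ∈ Ioi (0:ℝ), ∫ x in Ioi (0:ℝ), l ^ (-ν) * exp (-((2 + l * t) * x)) = l ^ (-ν) * (1 / (2 + l * t)) := by
    intro l hl
    have hl0 : (0:ℝ) < l := hl
    rw [integral_const_mul]
    congr 1
    have := Real.integral_rpow_mul_exp_neg_mul_Ioi (a := 1) (r := 2 + l * t) one_pos (by positivity)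
    simpa using this
  have h2' : ∀ x l : ℝ, l ^ (-ν) * exp (-((2 + l * t) * x)) =
      exp (-(2 * x)) * (l ^ (-ν) * exp (-((t * x) * l))) := by
    intro x l
    rw [mul_left_comm, ← exp_add]; ring_nf
  have h2 : ∀ x ∈ Ioi (0:ℝ), ∫ l in Ioi (0:ℝ), l ^ (-ν) * exp (-((2 + l * t) * x)) =
      (t ^ (ν - 1) * Gamma (1 - ν)) * (x ^ (ν - 1) * exp (-(2 * x))) := by
    intro x hx
    have hx0 : (0:ℝ) < x := hx
    simp_rw [h2']
    rw [integral_const_mul, laplace_rpow ν _ hν (by positivity), mul_rpow ht.le hx0.le]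
    ring
  have hIntg : Integrable (Function.uncurry fun l x : ℝ => l ^ (-ν) * exp (-((2 + l * t) * x)))
      ((volume.restrict (Ioi 0)).prod (volume.restrict (Ioi 0))) := by
    rw [integrable_prod_iff' (Measurable.aestronglyMeasurable (by unfold Function.uncurry; fun_prop))]
    constructor
    · refine (ae_restrict_iff' measurableSet_Ioi).2 (Filter.Eventually.of_forall fun x hx => ?_)
      have hx0 : (0:ℝ) < x := hx
      simp only [Function.uncurry, h2']
      exact (laplace_integrable ν _ hν (by positivity)).const_mul _
    · have hi : IntegrableOn (fun x : ℝ => (t ^ (ν - 1) * Gamma (1 - ν)) * (x ^ (ν - 1) * exp (-(2 * x)))) (Ioi 0) := by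
        apply Integrable.const_mul
        apply Integrable.of_integral_ne_zero
        rw [Real.integral_rpow_mul_exp_neg_mul_Ioi hν0 two_pos]
        have := Gamma_pos_of_pos hν0
        positivity
      refine hi.congr ((ae_restrict_iff' measurableSet_Ioi).2 (Filter.Eventually.of_forall fun x hx => ?_))
      beta_reduce
      rw [← h2 x hx]
      refine setIntegral_congr_fun measurableSet_Ioi fun l hl => ?_
      have hl0 : (0:ℝ) < l := hl
      simp only [Function.uncurry]
      rw [Real.norm_of_nonneg (by positivity)]
  constructor
  · exact (hIntg.integral_prod_left).congr ((ae_restrict_iff' measurableSet_Ioi).2 (Filter.Eventually.of_forall h1))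
  · rw [← setIntegral_congr_fun measurableSet_Ioi h1, integral_integral_swap hIntg,
      setIntegral_congr_fun measurableSet_Ioi h2, integral_const_mul,
      Real.integral_rpow_mul_exp_neg_mul_Ioi hν0 two_pos, one_div, inv_rpow two_pos.le, ← rpow_neg two_pos.le]
    ring

section frac
variable {H : Type*} [NormedAddCommGroup H] [InnerProductSpace ℝ H] [CompleteSpace H]

lemma kernel_bound (l s t m C : ℝ) (hl : 0 < l) (hs : 0 < s) (hst : s ≤ t) (hm0 : 0 ≤ m) (hm : m < 1)
    (hC : 0 ≤ C) (f : ℝ → H) (hf : StronglyMeasurable f) (hb : ∀ s, 0 < s → ‖f s‖ ≤ C * s ^ (-m)) :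
    IntegrableOn (fun r => exp (-(l * (s - r))) • f r) (Ioc 0 s) ∧
    ∫ r in Ioc 0 s, ‖exp (-(l * (s - r))) • f r‖ ≤
      min (C * (t ^ (1 - m) / (1 - m))) (C * (1 / (1 - m) + 1) * l ^ (m - 1)) := by
  have hIntg : IntegrableOn (fun r : ℝ => C * (exp (-(l * (s - r))) * r ^ (-m))) (Ioc 0 s) := by
    have := intervalIntegral.intervalIntegrable_rpow' (a := 0) (b := s) (r := -m) (by linarith)
    have := this.continuousOn_mul (g := fun r => exp (-(l * (s - r)))) (by fun_prop)
    rw [intervalIntegrable_iff_integrableOn_Ioc_of_le hs.le] at this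
    exact Integrable.const_mul this _
  have hle : ∀ r ∈ Ioc 0 s, ‖exp (-(l * (s - r))) • f r‖ ≤ C * (exp (-(l * (s - r))) * r ^ (-m)) := by
    intro r hr
    rw [norm_smul, Real.norm_of_nonneg (exp_pos _).le, mul_left_comm]
    gcongr
    exact hb r hr.1
  have hI : IntegrableOn (fun r => exp (-(l * (s - r))) • f r) (Ioc 0 s) := by
    refine Integrable.mono' hIntg ?_ ((ae_restrict_iff' measurableSet_Ioc).2 (Filter.Eventually.of_forall hle))
    refine StronglyMeasurable.aestronglyMeasurable ?_
    exact StronglyMeasurable.smul (Continuous.stronglyMeasurable (by fun_prop)) hf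
  refine ⟨hI, ?_⟩
  have h1 : ∫ r in Ioc 0 s, ‖exp (-(l * (s - r))) • f r‖ ≤ C * ∫ r in Ioc 0 s, (exp (-(l * (s - r))) * r ^ (-m)) := by
    rw [← integral_const_mul]
    exact setIntegral_mono_on hI.norm hIntg measurableSet_Ioc hle
  have h2 := exp_bound l s m hl hs hm0 hm
  have hm' : 0 < 1 - m := by linarith
  refine h1.trans (le_min ?_ ?_)
  · refine mul_le_mul_of_nonneg_left ((h2.trans (min_le_left _ _)).trans ?_) hC
    gcongr
  · rw [mul_assoc]
    exact mul_le_mul_of_nonneg_left (h2.trans (min_le_right _ _)) hC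

lemma frac_repr (s t m ν C : ℝ) (hs : 0 < s) (hst : s ≤ t) (hm0 : 0 ≤ m) (hmν : m < ν) (hν : ν < 1)
    (hC : 0 ≤ C) (f : ℝ → H) (hf : StronglyMeasurable f) (hb : ∀ s, 0 < s → ‖f s‖ ≤ C * s ^ (-m)) :
    (Gamma ν * Gamma (1 - ν)) • ∫ r in Ioc 0 s, omegaK ν (s - r) • f r =
      ∫ l in Ioi (0:ℝ), l ^ (-ν) • ∫ r in Ioc 0 s, exp (-(l * (s - r))) • f r := by
  have hm : m < 1 := hmν.trans hν
  have hm' : 0 < 1 - m := by linarith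
  have ht : 0 < t := hs.trans_le hst
  have hIntg : Integrable (Function.uncurry fun r l : ℝ => l ^ (-ν) • (exp (-(l * (s - r))) • f r))
      ((volume.restrict (Ioc 0 s)).prod (volume.restrict (Ioi 0))) := by
    have hsm : StronglyMeasurable (Function.uncurry fun r l : ℝ => l ^ (-ν) • (exp (-(l * (s - r))) • f r)) := by
      unfold Function.uncurry
      refine StronglyMeasurable.smul (Measurable.stronglyMeasurable (by fun_prop)) ?_
      refine StronglyMeasurable.smul (Measurable.stronglyMeasurable (by fun_prop)) ?_
      exact hf.comp_measurable measurable_fst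
    rw [integrable_prod_iff' hsm.aestronglyMeasurable]
    constructor
    · refine (ae_restrict_iff' measurableSet_Ioi).2 (Filter.Eventually.of_forall fun l hl => ?_)
      exact (kernel_bound l s t m C hl hs hst hm0 hm hC f hf hb).1.smul (l ^ (-ν))
    · refine Integrable.mono' (dom_integrable m ν (C * (t ^ (1 - m) / (1 - m))) (C * (1 / (1 - m) + 1))
        hmν hν (by positivity) (by positivity)) ?_ ?_
      · have := hsm.norm.integral_prod_left' (μ := volume.restrict (Ioc 0 s))
        exact this.aestronglyMeasurable
      · refine (ae_restrict_iff' measurableSet_Ioi).2 (Filter.Eventually.of_forall fun l hl => ?_)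
        have hl0 : (0:ℝ) < l := hl
        rw [Real.norm_of_nonneg (integral_nonneg fun _ => norm_nonneg _)]
        simp only [Function.uncurry]
        simp_rw [norm_smul (l ^ (-ν))]
        rw [integral_const_mul, Real.norm_of_nonneg (by positivity)]
        gcongr
        exact (kernel_bound l s t m C hl hs hst hm0 hm hC f hf hb).2
  have hne : ∀ᵐ r ∂(volume : Measure ℝ), r ≠ s := by simp [ae_iff]
  rw [← integral_smul]
  have hR : ∀ l : ℝ, l ^ (-ν) • ∫ r in Ioc 0 s, exp (-(l * (s - r))) • f r
      = ∫ r in Ioc 0 s, l ^ (-ν) • (exp (-(l * (s - r))) • f r) := fun l => (integral_smul _ _).symm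
  simp_rw [hR]
  rw [← integral_integral_swap hIntg]
  refine integral_congr_ae ((ae_restrict_iff' measurableSet_Ioc).2 ?_)
  filter_upwards [hne] with r hr hr'
  have hsr : 0 < s - r := sub_pos.2 (lt_of_le_of_ne hr'.2 hr)
  simp_rw [smul_smul]
  rw [integral_smul_const]
  congr 1
  have := laplace_rpow ν (s - r) hν hsr
  simp_rw [mul_comm _ (s - r)]
  rw [this, omegaK]
  have := (Gamma_pos_of_pos (hm0.trans_lt hmν)).ne'
  field_simp

lemma frac_main (t m ν C : ℝ) (ht : 0 < t) (hm0 : 0 ≤ m) (hmν : m < ν) (hν : ν < 1)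
    (hC : 0 ≤ C) (φ f : ℝ → H) (hf : StronglyMeasurable f) (hb : ∀ s, 0 < s → ‖f s‖ ≤ C * s ^ (-m))
    (hφ : Continuous φ) (h0 : φ 0 = 0) (hd : ∀ s ∈ Ioo 0 t, HasDerivAt φ (f s) s) :
    ‖φ t‖ ^ 2 ≤ 2 * omegaK (2 - ν) t * ∫ s in Ioc 0 t, ⟪f s, ∫ r in Ioc 0 s, omegaK ν (s - r) • f r⟫ := by
  have hm : m < 1 := hmν.trans hν
  have hm' : 0 < 1 - m := by linarith
  have hν0 : 0 < ν := hm0.trans_lt hmν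
  have hrp : IntegrableOn (fun s : ℝ => C * s ^ (-m)) (Ioc 0 t) := by
    have := intervalIntegral.intervalIntegrable_rpow' (a := 0) (b := t) (r := -m) (by linarith)
    rw [intervalIntegrable_iff_integrableOn_Ioc_of_le ht.le] at this
    exact Integrable.const_mul this _
  have hfi : IntervalIntegrable f volume 0 t := by
    rw [intervalIntegrable_iff_integrableOn_Ioc_of_le ht.le]
    exact Integrable.mono' hrp hf.aestronglyMeasurable
      ((ae_restrict_iff' measurableSet_Ioc).2 (Filter.Eventually.of_forall fun s hs => hb s hs.1))
  obtain ⟨U, hU⟩ : ∃ U : ℝ → ℝ → H, U = fun l s => ∫ r in Ioc 0 s, exp (-(l * (s - r))) • f r := ⟨_, rfl⟩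
  have hUm : StronglyMeasurable (fun p : ℝ × ℝ => U p.2 p.1) := by
    have : (fun p : ℝ × ℝ => U p.2 p.1) = fun p : ℝ × ℝ => ∫ r, (fun (p : ℝ × ℝ) (r : ℝ) =>
        ({q : (ℝ × ℝ) × ℝ | 0 < q.2 ∧ q.2 ≤ q.1.1}).indicator
          (fun q : (ℝ × ℝ) × ℝ => exp (-(q.1.2 * (q.1.1 - q.2))) • f q.2) (p, r)) p r := by
      ext1 p
      rw [hU]
      simp only
      rw [← integral_indicator measurableSet_Ioc]
      rfl
    rw [this]
    apply StronglyMeasurable.integral_prod_right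
    refine StronglyMeasurable.indicator ?_ ?_
    · refine StronglyMeasurable.smul (Measurable.stronglyMeasurable (by fun_prop)) ?_
      exact hf.comp_measurable measurable_snd
    · exact (measurableSet_lt measurable_const measurable_snd).inter
        (measurableSet_le measurable_snd (by fun_prop))
  have hUb : ∀ l s, 0 < l → s ∈ Ioc 0 t → ‖U l s‖ ≤
      min (C * (t ^ (1 - m) / (1 - m))) (C * (1 / (1 - m) + 1) * l ^ (m - 1)) := by
    intro l s hl hs
    rw [hU]
    exact (norm_integral_le_integral_norm _).trans
      (kernel_bound l s t m C hl hs.1 hs.2 hm0 hm hC f hf hb).2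
  have hdom := dom_integrable m ν (C * (t ^ (1 - m) / (1 - m))) (C * (1 / (1 - m) + 1))
        hmν hν (by positivity) (by positivity)
  have hUi : ∀ s ∈ Ioc 0 t, IntegrableOn (fun l : ℝ => l ^ (-ν) • U l s) (Ioi 0) := by
    intro s hs
    refine Integrable.mono' hdom ?_ ?_
    · refine StronglyMeasurable.aestronglyMeasurable ?_
      refine StronglyMeasurable.smul (Measurable.stronglyMeasurable (by fun_prop)) ?_
      exact hUm.comp_measurable (g := fun l : ℝ => (s, l)) (by fun_prop)
    · refine (ae_restrict_iff' measurableSet_Ioi).2 (Filter.Eventually.of_forall fun l hl => ?_)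
      have hl0 : (0:ℝ) < l := hl
      rw [norm_smul, Real.norm_of_nonneg (by positivity)]
      gcongr
      exact hUb l s hl hs
  have hIntg : Integrable (Function.uncurry fun s l : ℝ => ⟪f s, l ^ (-ν) • U l s⟫)
      ((volume.restrict (Ioc 0 t)).prod (volume.restrict (Ioi 0))) := by
    refine Integrable.mono' (Integrable.mul_prod hrp hdom) ?_ ?_
    · refine StronglyMeasurable.aestronglyMeasurable ?_
      unfold Function.uncurry
      refine StronglyMeasurable.inner (hf.comp_measurable measurable_fst) ?_
      exact StronglyMeasurable.smul (Measurable.stronglyMeasurable (by fun_prop)) hUm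
    · rw [Measure.prod_restrict]
      refine (ae_restrict_iff' (measurableSet_Ioc.prod measurableSet_Ioi)).2 (Filter.Eventually.of_forall fun p hp => ?_)
      obtain ⟨hp1, hp2⟩ := hp
      have hl0 : (0:ℝ) < p.2 := hp2
      have hs0 : (0:ℝ) < p.1 := hp1.1
      refine (norm_inner_le_norm _ _).trans ?_
      rw [norm_smul, Real.norm_of_nonneg (by positivity)]
      gcongr
      · exact hb _ hs0
      · exact hUb _ _ hl0 hp1
  have hGν := Gamma_pos_of_pos hν0
  have hG1 := Gamma_pos_of_pos (show 0 < 1 - ν by linarith)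
  have hG2 := Gamma_pos_of_pos (show 0 < 2 - ν by linarith)
  set Q := ∫ s in Ioc 0 t, ⟪f s, ∫ r in Ioc 0 s, omegaK ν (s - r) • f r⟫ with hQ
  have hQ1 : (Gamma ν * Gamma (1 - ν)) * Q = ∫ l in Ioi (0:ℝ), ∫ s in Ioc 0 t, ⟪f s, l ^ (-ν) • U l s⟫ := by
    rw [← integral_integral_swap hIntg, hQ, ← integral_const_mul]
    refine setIntegral_congr_fun measurableSet_Ioc fun s hs => ?_
    beta_reduce
    rw [integral_inner (hUi s hs), ← inner_smul_right, frac_repr s t m ν C hs.1 hs.2 hm0 hmν hν hC f hf hb, hU]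
  obtain ⟨hst1, hst2⟩ := stieltjes ν t hν0 hν ht
  have hlow : ‖φ t‖^2 * (Gamma ν * Gamma (1 - ν) * (2 ^ (-ν) * t ^ (ν - 1))) ≤ (Gamma ν * Gamma (1 - ν)) * Q := by
    rw [hQ1, ← hst2, ← integral_const_mul]
    refine setIntegral_mono_on (hst1.const_mul _) hIntg.integral_prod_right measurableSet_Ioi fun l hl => ?_
    have hl0 : (0:ℝ) < l := hl
    have h := exp_energy l t hl0.le ht φ f hφ h0 hd hfi
    simp_rw [inner_smul_right]
    rw [integral_const_mul, hU, mul_left_comm]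
    gcongr
    rw [mul_one_div, div_le_iff₀ (by positivity), mul_comm]
    exact h
  have hlow2 : ‖φ t‖^2 * (2 ^ (-ν) * t ^ (ν - 1)) ≤ Q := by
    have hp : 0 < Gamma ν * Gamma (1 - ν) := by positivity
    refine le_of_mul_le_mul_left ?_ hp
    linarith
  have hGle : Gamma (2 - ν) ≤ 1 := by
    have := Real.convexOn_Gamma.2 (x := 1) (y := 2) (by simp) (by simp) hν0.le
      (show 0 ≤ 1 - ν by linarith) (by ring)
    simp only [smul_eq_mul, Gamma_one, Gamma_two] at this
    rw [show ν * 1 + (1 - ν) * 2 = 2 - ν by ring] at this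
    linarith
  have h2 : (1:ℝ) ≤ 2 * 2 ^ (-ν) := by
    have : (2:ℝ) * 2 ^ (-ν) = 2 ^ (1 - ν) := by rw [sub_eq_add_neg, rpow_add two_pos, rpow_one]
    rw [this]
    exact one_le_rpow (by norm_num) (by linarith)
  have ho : omegaK (2 - ν) t = t ^ (1 - ν) / Gamma (2 - ν) := by rw [omegaK]; ring_nf
  have ho1 : t ^ (1 - ν) ≤ omegaK (2 - ν) t := by
    rw [ho, le_div_iff₀ hG2]
    exact mul_le_of_le_one_right (by positivity) hGle
  have hQ0 : 0 ≤ Q := le_trans (by positivity) hlow2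
  have htt : t ^ (1 - ν) * t ^ (ν - 1) = 1 := by rw [← rpow_add ht]; simp
  calc ‖φ t‖^2 ≤ ‖φ t‖^2 * (2 * 2 ^ (-ν)) := le_mul_of_one_le_right (by positivity) h2
    _ = 2 * t ^ (1 - ν) * (‖φ t‖^2 * (2 ^ (-ν) * t ^ (ν - 1))) := by
        linear_combination (-(‖φ t‖^2 * (2 * 2 ^ (-ν)))) * htt
    _ ≤ 2 * t ^ (1 - ν) * Q := by gcongr
    _ ≤ _ := by gcongr

end frac

/-- if `0 ≤ μ < ν ≤ 1`, `φ : [0,T] → L²(Ω)` is continuous with `φ(0) = 0`,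
differentiable on `(0,T]` with `‖φ'(t)‖ ≤ C₀ t^{-μ}`, then for `0 < t ≤ T`,
`‖φ(t)‖² ≤ 2 ω_{2-ν}(t) ∫_0^t ⟨φ'(s), (I^ν φ')(s)⟩ ds`. -/
theorem stmt_3 {d : ℕ} (hd : 1 ≤ d) (Ω : Set (EuclideanSpace ℝ (Fin d)))
    (hΩ : MeasurableSet Ω)
    (μ ν T : ℝ) (hμ0 : 0 ≤ μ) (hμν : μ < ν) (hν1 : ν ≤ 1) (hT : 0 < T)
    (φ φ' : ℝ → Lp ℝ 2 (volume.restrict Ω))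
    (hcont : ContinuousOn φ (Icc 0 T)) (h0 : φ 0 = 0)
    (hderiv : ∀ s ∈ Ioc (0:ℝ) T, HasDerivWithinAt φ (φ' s) (Ioc (0:ℝ) T) s)
    (C₀ : ℝ) (hbound : ∀ s ∈ Ioc (0:ℝ) T, ‖φ' s‖ ≤ C₀ * s ^ (-μ)) :
    ∀ t ∈ Ioc (0:ℝ) T,
      ‖φ t‖ ^ 2 ≤ 2 * omegaK (2 - ν) t * ∫ s in (0:ℝ)..t, ⟪φ' s, fracInt ν φ' s⟫ := by
  intro t ht
  have ht0 : 0 < t := ht.1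
  have hC : 0 ≤ C₀ := by
    have h1 := (norm_nonneg _).trans (hbound t ht)
    exact nonneg_of_mul_nonneg_left h1 (rpow_pos_of_pos ht0 _)
  have hd : ∀ s ∈ Ioo 0 t, HasDerivAt φ (φ' s) s := by
    intro s hs
    exact (hderiv s ⟨hs.1, hs.2.le.trans ht.2⟩).hasDerivAt (Ioc_mem_nhds hs.1 (hs.2.trans_le ht.2))
  obtain ⟨f, hfdef⟩ : ∃ f, f = (Ioo 0 t).indicator (deriv φ) := ⟨_, rfl⟩
  have hff : ∀ s ∈ Ioo 0 t, f s = φ' s := by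
    intro s hs
    rw [hfdef, indicator_of_mem hs, (hd s hs).deriv]
  have hf : StronglyMeasurable f := by
    rw [hfdef]
    exact (stronglyMeasurable_deriv φ).indicator measurableSet_Ioo
  have hb : ∀ s, 0 < s → ‖f s‖ ≤ C₀ * s ^ (-μ) := by
    intro s hs
    by_cases h : s ∈ Ioo 0 t
    · rw [hff s h]
      exact hbound s ⟨h.1, h.2.le.trans ht.2⟩
    · rw [hfdef, indicator_of_notMem h, norm_zero]
      positivity
  obtain ⟨ψ, hψ⟩ : ∃ ψ, ψ = IccExtend ht0.le ((Icc 0 t).domRestrict φ) := ⟨_, rfl⟩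
  have hψc : Continuous ψ := by
    rw [hψ]
    exact (continuousOn_iff_continuous_domRestrict.1 (hcont.mono (Icc_subset_Icc_right ht.2))).Icc_extend'
  have hψe : ∀ s ∈ Icc 0 t, ψ s = φ s := by
    intro s hs
    rw [hψ, IccExtend_of_mem _ _ hs]
    rfl
  have hψ0 : ψ 0 = 0 := by rw [hψe 0 ⟨le_rfl, ht0.le⟩, h0]
  have hψd : ∀ s ∈ Ioo 0 t, HasDerivAt ψ (f s) s := by
    intro s hs
    rw [hff s hs]
    refine (hd s hs).congr_of_eventuallyEq ?_
    filter_upwards [Icc_mem_nhds hs.1 hs.2] with r hr using hψe r hr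
  have hν0 : ν ≠ 0 := (hμ0.trans_lt hμν).ne'
  have hQ : ∫ s in (0:ℝ)..t, ⟪φ' s, fracInt ν φ' s⟫ =
      ∫ s in Ioc 0 t, ⟪f s, ∫ r in Ioc 0 s, omegaK ν (s - r) • f r⟫ := by
    rw [intervalIntegral.integral_of_le ht0.le]
    have hne : ∀ᵐ r ∂(volume : Measure ℝ), r ≠ t := by simp [ae_iff]
    refine integral_congr_ae ((ae_restrict_iff' measurableSet_Ioc).2 ?_)
    filter_upwards [hne] with s hs hs'
    have hst : s < t := lt_of_le_of_ne hs'.2 hs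
    rw [hff s ⟨hs'.1, hst⟩, fracInt, if_neg hν0, intervalIntegral.integral_of_le hs'.1.le]
    congr 1
    refine setIntegral_congr_fun measurableSet_Ioc fun r hr => ?_
    beta_reduce
    rw [hff r ⟨hr.1, hr.2.trans_lt hst⟩]
  rw [hQ, ← hψe t ⟨ht0.le, le_rfl⟩]
  rcases hν1.lt_or_eq with hν | hν
  · exact frac_main t μ ν C₀ ht0 hμ0 hμν hν hC ψ f hf hb hψc hψ0 hψd
  · subst hν
    have hfi : IntervalIntegrable f volume 0 t := by
      have := intervalIntegral.intervalIntegrable_rpow' (a := 0) (b := t) (r := -μ) (by linarith)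
      rw [intervalIntegrable_iff_integrableOn_Ioc_of_le ht0.le] at this ⊢
      exact Integrable.mono' (Integrable.const_mul this C₀) hf.aestronglyMeasurable
        ((ae_restrict_iff' measurableSet_Ioc).2 (Filter.Eventually.of_forall fun s hs => hb s hs.1))
    have h := exp_energy 0 t le_rfl ht0 ψ f hψc hψ0 hψd hfi
    have h1 : omegaK (2 - 1) t = 1 := by norm_num [omegaK]
    have h2 : ∀ x, omegaK 1 x = 1 := by intro x; norm_num [omegaK]
    rw [h1]
    simp_rw [h2]
    simpa using h
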